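/- Let H = (1/√2) • !![1, 1; 1, -1] be the Hadamard matrix, let S be the SWAP matrix on ℂ² ⊗ ℂ², let CH be the controlled-Hadamard (controlled unitary with U_0 = identity, U_1 = H, control on the first factor), and set V = CH * S. Then for the input state ψ = |−⟩ = (e_0 − e_1)/√2: (a) any 2×2 density matrix ρ satisfying the Deutsch self-consistency condition ρ = Tr₁[V (|ψ⟩⟨ψ| ⊗ ρ) V†] equals |e_1⟩⟨e_1|, and (b) the output state Tr₂[V (|ψ⟩⟨ψ| ⊗ |e_1⟩⟨e_1|) V†] equals |e_1⟩⟨e_1|. Hence the circuit perfectly distinguishes the non-orthogonal states |0⟩ and |−⟩. -/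

import Mathlib

open Matrix Kronecker
open scoped ComplexConjugate ComplexOrder

noncomputable section

/-- The `j`-th standard basis vector of `ℂ^N`. -/
def stdVec {N : ℕ} (j : Fin N) : Fin N → ℂ := fun i => if i = j then 1 else 0

/-- The outer product `|φ⟩⟨χ|`. -/
def outer {ι : Type*} (φ χ : ι → ℂ) : Matrix ι ι ℂ :=
  Matrix.of fun m n => φ m * conj (χ n)

/-- Partial trace over the first tensor factor. -/
def ptrace1 {d N : ℕ} (M : Matrix (Fin d × Fin N) (Fin d × Fin N) ℂ) :
    Matrix (Fin N) (Fin N) ℂ :=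
  Matrix.of fun m n => ∑ s : Fin d, M (s, m) (s, n)

/-- Partial trace over the second tensor factor. -/
def ptrace2 {d N : ℕ} (M : Matrix (Fin d × Fin N) (Fin d × Fin N) ℂ) :
    Matrix (Fin d) (Fin d) ℂ :=
  Matrix.of fun m n => ∑ s : Fin N, M (m, s) (n, s)

/-- The SWAP matrix on `ℂ^N ⊗ ℂ^N`. -/
def swapMat (N : ℕ) : Matrix (Fin N × Fin N) (Fin N × Fin N) ℂ :=
  Matrix.of fun p q => if p.1 = q.2 ∧ p.2 = q.1 then 1 else 0

/-- The controlled unitary `Σ_k |k⟩⟨k| ⊗ U_k` (control on the first factor). -/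
def ctrlU {N : ℕ} (U : Fin N → Matrix (Fin N) (Fin N) ℂ) :
    Matrix (Fin N × Fin N) (Fin N × Fin N) ℂ :=
  Matrix.of fun p q => if p.1 = q.1 then U p.1 p.2 q.2 else 0

/-- The Hadamard matrix. -/
def Hmat : Matrix (Fin 2) (Fin 2) ℂ :=
  ((1 / Real.sqrt 2 : ℝ) : ℂ) • !![1, 1; 1, -1]

/-- The controlled-Hadamard gate (`U_0 = I`, `U_1 = H`, control on the first factor). -/
def CH : Matrix (Fin 2 × Fin 2) (Fin 2 × Fin 2) ℂ :=
  ctrlU ![(1 : Matrix (Fin 2) (Fin 2) ℂ), Hmat]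

/-- The state `|−⟩ = (|0⟩ − |1⟩)/√2`. -/
def minusVec : Fin 2 → ℂ :=
  ((1 / Real.sqrt 2 : ℝ) : ℂ) • (stdVec 0 - stdVec 1)

theorem ctrlU_mul_swapMat_apply {N : ℕ} (U : Fin N → Matrix (Fin N) (Fin N) ℂ)
    (p q : Fin N × Fin N) :
    (ctrlU U * swapMat N) p q = if p.1 = q.2 then U p.1 p.2 q.1 else 0 := by
  obtain ⟨a, b⟩ := p
  obtain ⟨c, d⟩ := q
  simp [Matrix.mul_apply, ctrlU, swapMat, Fintype.sum_prod_type, ite_and]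

/-- Swapping a pure state `ψ` with `ρ` and applying a controlled unitary turns `ψ` into `U a ψ`
on the block of `ρ` with control value `a`. -/
theorem ctrlU_mul_swapMat_conj_apply {N : ℕ} (U : Fin N → Matrix (Fin N) (Fin N) ℂ)
    (ψ : Fin N → ℂ) (ρ : Matrix (Fin N) (Fin N) ℂ) (a b c d : Fin N) :
    ((ctrlU U * swapMat N) * (outer ψ ψ ⊗ₖ ρ) * (ctrlU U * swapMat N)ᴴ) (a, b) (c, d) =
      ρ a c * outer (U a *ᵥ ψ) (U c *ᵥ ψ) b d := by
  rw [Matrix.mul_apply]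
  simp only [Matrix.mul_apply (M := ctrlU U * swapMat N), conjTranspose_apply,
    ctrlU_mul_swapMat_apply, kroneckerMap_apply, outer, of_apply, Fintype.sum_prod_type,
    mulVec, dotProduct, map_sum, map_mul, apply_ite star, star_zero, ite_mul, mul_ite,
    zero_mul, mul_zero, Finset.sum_ite_eq, Finset.mem_univ, if_true, Finset.sum_mul,
    Finset.mul_sum, RCLike.star_def]
  refine Finset.sum_congr rfl fun i _ => Finset.sum_congr rfl fun j _ => ?_
  ring

theorem inv_sqrt_two_mul_self :
    ((1 / Real.sqrt 2 : ℝ) : ℂ) * ((1 / Real.sqrt 2 : ℝ) : ℂ) = 1 / 2 := by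
  rw [← Complex.ofReal_mul, div_mul_div_comm, Real.mul_self_sqrt zero_le_two]
  norm_num

theorem Hmat_mulVec_minusVec : Hmat *ᵥ minusVec = stdVec 1 := by
  rw [Hmat, minusVec, smul_mulVec, mulVec_smul, smul_smul, inv_sqrt_two_mul_self]
  ext i
  fin_cases i <;> norm_num [stdVec, mulVec, dotProduct, Fin.sum_univ_two]

theorem outer_minusVec : outer minusVec minusVec = !![1 / 2, -1 / 2; -1 / 2, 1 / 2] := by
  have h := inv_sqrt_two_mul_self
  ext i j
  fin_cases i <;> fin_cases j <;>
    simp [outer, minusVec, stdVec] at h ⊢ <;>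
    first | linear_combination h | linear_combination -h

/-- For input `|−⟩`, the unique self-consistent CTC state of the
controlled-Hadamard-after-SWAP circuit is `|1⟩⟨1|`, and the output state is `|1⟩⟨1|`;
hence the circuit perfectly distinguishes `|0⟩` and `|−⟩`. -/
theorem ctc_circuit_on_minus :
    (∀ ρ : Matrix (Fin 2) (Fin 2) ℂ, ρ.PosSemidef → ρ.trace = 1 →
        ρ = ptrace1 ((CH * swapMat 2) *
              (outer minusVec minusVec ⊗ₖ ρ) * (CH * swapMat 2)ᴴ) →
        ρ = outer (stdVec 1) (stdVec 1)) ∧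
    ptrace2 ((CH * swapMat 2) *
        (outer minusVec minusVec ⊗ₖ outer (stdVec 1) (stdVec 1)) *
        (CH * swapMat 2)ᴴ) = outer (stdVec 1) (stdVec 1) := by
  refine ⟨fun ρ _ htr hfix => ?_, ?_⟩
  · have entry (m n : Fin 2) : ρ m n = ρ 0 0 * outer minusVec minusVec m n +
        ρ 1 1 * outer (stdVec 1) (stdVec 1) m n := by
      conv_lhs => rw [hfix]
      simp only [ptrace1, CH, of_apply, ctrlU_mul_swapMat_conj_apply, Fin.sum_univ_two,
        cons_val_zero, cons_val_one, one_mulVec, Hmat_mulVec_minusVec]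
    rw [outer_minusVec] at entry
    have h00 : ρ 0 0 = 0 := by
      have h := entry 0 0
      simp [outer, stdVec] at h
      linear_combination 2 * h
    have h11 : ρ 1 1 = 1 := by
      simpa [Matrix.trace_fin_two, h00] using htr
    ext m n
    rw [entry, h00, h11, zero_mul, zero_add, one_mul]
  · ext m n
    simp only [ptrace2, CH, of_apply, ctrlU_mul_swapMat_conj_apply, Fin.sum_univ_two]
    fin_cases m <;> fin_cases n <;>
      simp only [Fin.zero_eta, Fin.mk_one, cons_val_zero, cons_val_one, Hmat_mulVec_minusVec] <;>
      simp [outer, stdVec]
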